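/- Let B be a unital ℂ-algebra with a conjugate-linear involutive anti-automorphism b ↦ b*, and let M^α_j ∈ B (α, j ∈ {1,…,4}) satisfy the relations M^α_j M^β_l = η_{jl} η_{βα} M^β_l M^α_j and (M^α_j)* M^β_l = η_{lj} η_{αβ} M^β_l (M^α_j)* for all α, β, j, l. Then the elements m_{αβ} := Σ_{l=1}^{4} (M^α_l)* M^β_l satisfy m_{αβ} m_{μν} = η_{βμ} η_{νβ} η_{μα} η_{αν} m_{μν} m_{αβ} for all α, β, μ, ν ∈ {1,…,4}. -/

import Mathlib

open Matrix

/-- The deformation parameter μ = exp(πiθ). -/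
noncomputable def muDef (θ : ℝ) : ℂ := Complex.exp (Real.pi * Complex.I * θ)

/-- The 4×4 matrix of deformation parameters η. -/
noncomputable def etaDef (θ : ℝ) : Fin 4 → Fin 4 → ℂ :=
  ![![1, 1, starRingEnd ℂ (muDef θ), muDef θ],
    ![1, 1, muDef θ, starRingEnd ℂ (muDef θ)],
    ![muDef θ, starRingEnd ℂ (muDef θ), 1, 1],
    ![starRingEnd ℂ (muDef θ), muDef θ, 1, 1]]

theorem muDef_mul_conj (θ : ℝ) : muDef θ * starRingEnd ℂ (muDef θ) = 1 := by
  have h : muDef θ = Complex.exp ((Real.pi * θ : ℝ) * Complex.I) := by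
    rw [muDef]
    congr 1
    push_cast
    ring
  rw [Complex.mul_conj, Complex.normSq_eq_norm_sq, h, Complex.norm_exp_ofReal_mul_I]
  norm_num

theorem etaDef_mul_swap (θ : ℝ) (j l : Fin 4) : etaDef θ j l * etaDef θ l j = 1 := by
  have h := muDef_mul_conj θ
  have h' := (mul_comm _ _).trans h
  fin_cases j <;> fin_cases l <;> simp [etaDef, h, h']

theorem star_etaDef (θ : ℝ) (j l : Fin 4) : star (etaDef θ j l) = etaDef θ l j := by
  fin_cases j <;> fin_cases l <;> simp [etaDef]

/-- Products of two pairs of elements which commute up to scalars commute up to the product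
of these scalars. -/
theorem mul_mul_mul_eq_smul_of_mul_eq_smul {R B : Type*} [CommRing R] [Ring B] [Algebra R B]
    {a b c d : B} {p q r s : R} (hbc : b * c = p • (c * b)) (hbd : b * d = q • (d * b))
    (hac : a * c = r • (c * a)) (had : a * d = s • (d * a)) :
    (a * b) * (c * d) = (p * q * r * s) • ((c * d) * (a * b)) := by
  calc (a * b) * (c * d) = a * (b * c) * d := by simp only [mul_assoc]
    _ = p • ((a * c) * (b * d)) := by
      simp only [hbc, mul_smul_comm, smul_mul_assoc, mul_assoc]
    _ = (p * q * r) • (c * (a * d) * b) := by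
      rw [hac, hbd]
      simp only [mul_smul_comm, smul_mul_assoc, smul_smul, mul_assoc]
    _ = (p * q * r * s) • ((c * d) * (a * b)) := by
      simp only [had, mul_smul_comm, smul_mul_assoc, smul_smul, mul_assoc]

/-- If M^α_j satisfy M^α_j M^β_l = η_{jl} η_{βα} M^β_l M^α_j and
(M^α_j)* M^β_l = η_{lj} η_{αβ} M^β_l (M^α_j)*, then the gauge-invariant elements
m_{αβ} = Σ_l (M^α_l)* M^β_l satisfy
m_{αβ} m_{μν} = η_{βμ} η_{νβ} η_{μα} η_{αν} m_{μν} m_{αβ}. -/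
theorem stmt14 (θ : ℝ) (B : Type*) [Ring B] [Algebra ℂ B] [StarRing B] [StarModule ℂ B]
    (M : Fin 4 → Fin 4 → B)
    (h1 : ∀ α β j l, M α j * M β l = (etaDef θ j l * etaDef θ β α) • (M β l * M α j))
    (h2 : ∀ α β j l,
      star (M α j) * M β l = (etaDef θ l j * etaDef θ α β) • (M β l * star (M α j))) :
    ∀ α β γ δ, (∑ l, star (M α l) * M β l) * (∑ l, star (M γ l) * M δ l) =
      (etaDef θ β γ * etaDef θ δ β * etaDef θ γ α * etaDef θ α δ) •
        ((∑ l, star (M γ l) * M δ l) * (∑ l, star (M α l) * M β l)) := by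
  intro α β γ δ
  rw [Finset.sum_mul_sum, Finset.sum_mul_sum, Finset.smul_sum, Finset.sum_comm]
  refine Finset.sum_congr rfl fun k _ => ?_
  rw [Finset.smul_sum]
  refine Finset.sum_congr rfl fun l _ => ?_
  have hbc : M β l * star (M γ k) =
      (etaDef θ k l * etaDef θ β γ) • (star (M γ k) * M β l) := by
    rw [h2 γ β k l, smul_smul, mul_mul_mul_comm, etaDef_mul_swap, etaDef_mul_swap, one_mul,
      one_smul]
  have hac : star (M α l) * star (M γ k) =
      (etaDef θ l k * etaDef θ γ α) • (star (M γ k) * star (M α l)) := by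
    rw [← star_mul, h1 γ α k l, star_smul, star_mul', star_mul, star_etaDef, star_etaDef,
      mul_comm]
  rw [mul_mul_mul_eq_smul_of_mul_eq_smul hbc (h1 β δ l k) hac (h2 α δ l k)]
  congr 1
  linear_combination (etaDef θ β γ * etaDef θ δ β * etaDef θ γ α * etaDef θ α δ) *
    (etaDef θ k l * etaDef θ l k + 1) * etaDef_mul_swap θ k l
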